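/- Let p3 and q2 be real parameters with q2 ≠ 0 and κ := p3/q2 > 0, and let φ : ℝ → ℝ be smooth. The function u(x,t) := t·cos(√κ·x) + φ(x) satisfies the PDE u_t = (p3²/(2q2))·∂_x(u²) + p3·∂_x(u·u_xx) + q2·u_xx·u_xxx on ℝ × ℝ if and only if φ satisfies the reduced ODE (p3²/q2)·φ·φ' + p3·(φ·φ'')' + q2·φ''·φ''' = cos(√κ·x) on ℝ. (This is the similarity reduction corresponding to the symmetry X₄ + X₂ in Case 5a of the group classification.) -/

import Mathlib

/-- `pdx u n x t` is the `n`-th partial derivative of `u` with respect to the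
first (space) variable, evaluated at `(x, t)`. -/
noncomputable def pdx (u : ℝ → ℝ → ℝ) (n : ℕ) (x t : ℝ) : ℝ :=
  iteratedDeriv n (fun y => u y t) x

/-- `pdt u x t` is the partial derivative of `u` with respect to the
second (time) variable, evaluated at `(x, t)`. -/
noncomputable def pdt (u : ℝ → ℝ → ℝ) (x t : ℝ) : ℝ :=
  deriv (fun s => u x s) t

/-- `u` satisfies the Case-5 PDE
`u_t = (p3^2/(2 q2))*(u^2)_x + p3*(u*u_xx)_x + q2*u_2x*u_3x`. -/
def SatPDE5 (p3 q2 : ℝ) (u : ℝ → ℝ → ℝ) : Prop :=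
  ∀ x t : ℝ,
    pdt u x t =
      (p3 ^ 2 / (2 * q2)) * deriv (fun y => (u y t) ^ 2) x
      + p3 * deriv (fun y => u y t * pdx u 2 y t) x
      + q2 * pdx u 2 x t * pdx u 3 x t

lemma rhs_factor (p3 q2 : ℝ) (hq2 : q2 ≠ 0) (f f1 f2 f3 : ℝ → ℝ)
    (h1 : ∀ x, HasDerivAt f (f1 x) x) (h2 : ∀ x, HasDerivAt f1 (f2 x) x)
    (h3 : ∀ x, HasDerivAt f2 (f3 x) x) :
    deriv f = f1 ∧ iteratedDeriv 2 f = f2 ∧ iteratedDeriv 3 f = f3 ∧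
    (∀ x, deriv (fun y => f y ^ 2) x = 2 * f x * f1 x) ∧
    (∀ x, deriv (fun y => f y * f2 y) x = f1 x * f2 x + f x * f3 x) := by
  have e1 : deriv f = f1 := funext fun x => (h1 x).deriv
  have e2 : deriv f1 = f2 := funext fun x => (h2 x).deriv
  have e3 : deriv f2 = f3 := funext fun x => (h3 x).deriv
  have i2 : iteratedDeriv 2 f = f2 := by
    rw [iteratedDeriv_succ, iteratedDeriv_one, e1, e2]
  refine ⟨e1, i2, ?_, ?_, ?_⟩
  · rw [iteratedDeriv_succ, i2, e3]
  · intro x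
    have := ((h1 x).fun_pow 2).deriv
    simpa using this
  · intro x
    exact ((h1 x).fun_mul (h3 x)).deriv

theorem stmt_15 (p3 q2 : ℝ) (hq2 : q2 ≠ 0) (hκ : 0 < p3 / q2)
    (φ : ℝ → ℝ) (hφ : ContDiff ℝ (⊤ : ℕ∞) φ) :
    SatPDE5 p3 q2 (fun x t => t * Real.cos (Real.sqrt (p3 / q2) * x) + φ x)
    ↔
    (∀ x : ℝ,
      (p3 ^ 2 / q2) * φ x * deriv φ x
        + p3 * deriv (fun y => φ y * iteratedDeriv 2 φ y) x
        + q2 * iteratedDeriv 2 φ x * iteratedDeriv 3 φ x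
      = Real.cos (Real.sqrt (p3 / q2) * x)) := by
  have hs : Real.sqrt (p3 / q2) ^ 2 = p3 / q2 := Real.sq_sqrt hκ.le
  set k := Real.sqrt (p3 / q2) with hk
  have hp : p3 = k ^ 2 * q2 := by rw [hs]; field_simp
  have hd : ∀ n : ℕ, ∀ x, HasDerivAt (iteratedDeriv n φ) (iteratedDeriv (n + 1) φ x) x := by
    intro n x
    rw [iteratedDeriv_succ]
    exact ((hφ.differentiable_iteratedDeriv n (by exact_mod_cast WithTop.coe_lt_top n)) x).hasDerivAt
  have d0 : ∀ x, HasDerivAt φ (iteratedDeriv 1 φ x) x := by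
    simpa using hd 0
  obtain ⟨a1, -, -, -, a5⟩ := rhs_factor p3 q2 hq2 φ _ _ _ d0 (hd 1) (hd 2)
  have hl : ∀ x, HasDerivAt (fun y : ℝ => k * y) k x := fun x => by
    simpa using (hasDerivAt_id x).const_mul k
  have hc : ∀ a x : ℝ, HasDerivAt (fun y => a * Real.cos (k * y)) (-(a * k) * Real.sin (k * x)) x := by
    intro a x
    exact (((hl x).cos).const_mul a).congr_deriv (by ring)
  have hsn : ∀ a x : ℝ, HasDerivAt (fun y => a * Real.sin (k * y)) (a * k * Real.cos (k * x)) x := by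
    intro a x
    exact (((hl x).sin).const_mul a).congr_deriv (by ring)
  have key : ∀ t, _ := fun t : ℝ => rhs_factor p3 q2 hq2
    (fun y => t * Real.cos (k * y) + φ y) _ _ _
    (fun x => (hc t x).fun_add (d0 x))
    (fun x => (hsn (-(t * k)) x).fun_add (hd 1 x))
    (fun x => (hc (-(t * k) * k) x).fun_add (hd 2 x))
  unfold SatPDE5 pdx pdt
  have ht : ∀ x t : ℝ, deriv (fun s => s * Real.cos (k * x) + φ x) t = Real.cos (k * x) := by
    intro x t
    simpa using (((hasDerivAt_id t).mul_const (Real.cos (k * x))).add_const (φ x)).deriv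
  have main : ∀ x t : ℝ, (p3 ^ 2 / (2 * q2)) * deriv (fun y => (t * Real.cos (k * y) + φ y) ^ 2) x
      + p3 * deriv (fun y => (t * Real.cos (k * y) + φ y) *
          iteratedDeriv 2 (fun y => t * Real.cos (k * y) + φ y) y) x
      + q2 * iteratedDeriv 2 (fun y => t * Real.cos (k * y) + φ y) x *
          iteratedDeriv 3 (fun y => t * Real.cos (k * y) + φ y) x =
      (p3 ^ 2 / q2) * φ x * deriv φ x
        + p3 * deriv (fun y => φ y * iteratedDeriv 2 φ y) x
        + q2 * iteratedDeriv 2 φ x * iteratedDeriv 3 φ x := by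
    intro x t
    obtain ⟨-, b2, b3, b4, b5⟩ := key t
    rw [b2, b3, b4, b5, a1, a5, hp]
    simp only [Nat.reduceAdd]
    field_simp
    ring
  constructor
  · intro h x
    have := h x 0
    rw [ht] at this
    rw [← main x 0]
    exact this.symm
  · intro h x t
    rw [ht, ← h x]
    exact (main x t).symm
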